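/- Every weighted graph G = (V,E) with edge weights w : E → ℝ≥0 and maximum vertex degree Δ admits an edge-stabilizer F with |F| ≤ Δ·γ(G); consequently, since every edge-stabilizer has cardinality at least ⌈γ(G)/2⌉, F is a 2Δ-approximation to a minimum edge-stabilizer. -/

import Mathlib

namespace Stabilizer

variable {V : Type*} [Fintype V] [DecidableEq V]

/-- The set of vertices covered by a finite set of edges. -/
def edgeVerts (C : Finset (Sym2 V)) : Set V := {v | ∃ e ∈ C, v ∈ e}

/-- A matching of `G`, given as a finite set of pairwise vertex-disjoint edges. -/
def IsMatching (G : SimpleGraph V) (M : Finset (Sym2 V)) : Prop :=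
  (↑M ⊆ G.edgeSet) ∧ ∀ e ∈ M, ∀ f ∈ M, e ≠ f → ∀ v : V, v ∈ e → v ∉ f

/-- The total weight of a finite set of edges. -/
noncomputable def setWeight (w : Sym2 V → ℝ) (M : Finset (Sym2 V)) : ℝ := ∑ e ∈ M, w e

/-- ν(G): the maximum weight of a matching of `G`. -/
noncomputable def nu (G : SimpleGraph V) (w : Sym2 V → ℝ) : ℝ :=
  sSup {r : ℝ | ∃ M : Finset (Sym2 V), IsMatching G M ∧ r = setWeight w M}

/-- A fractional matching of `G`. -/
def IsFracMatching (G : SimpleGraph V) (x : Sym2 V → ℝ) : Prop :=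
  (∀ e, 0 ≤ x e) ∧ (∀ e, e ∉ G.edgeSet → x e = 0) ∧ ∀ v : V, ∑ u : V, x s(v, u) ≤ 1

/-- The weight of a fractional matching. -/
noncomputable def fracWeight (w x : Sym2 V → ℝ) : ℝ := ∑ e : Sym2 V, w e * x e

/-- ν_f(G): the maximum weight of a fractional matching of `G`. -/
noncomputable def nuf (G : SimpleGraph V) (w : Sym2 V → ℝ) : ℝ :=
  sSup {r : ℝ | ∃ x : Sym2 V → ℝ, IsFracMatching G x ∧ r = fracWeight w x}

/-- A maximum-weight fractional matching of `G`. -/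
def IsMaxFracMatching (G : SimpleGraph V) (w x : Sym2 V → ℝ) : Prop :=
  IsFracMatching G x ∧ ∀ y : Sym2 V → ℝ, IsFracMatching G y → fracWeight w y ≤ fracWeight w x

/-- All entries lie in {0, 1/2, 1}. -/
def IsHalfIntegral (x : Sym2 V → ℝ) : Prop := ∀ e, x e = 0 ∨ x e = 1 / 2 ∨ x e = 1

/-- `C` is the edge set of an odd cycle of `G`. -/
def IsOddCycleEdgeSet (G : SimpleGraph V) (C : Finset (Sym2 V)) : Prop :=
  ∃ (v : V) (c : G.Walk v v), c.IsCycle ∧ Odd c.length ∧ c.edges.toFinset = C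

/-- `F` is the family 𝒞(x) of vertex-disjoint odd cycles carrying exactly the
half-valued edges of `x`. -/
def IsCycleFamily (G : SimpleGraph V) (x : Sym2 V → ℝ) (F : Finset (Finset (Sym2 V))) : Prop :=
  (∀ C ∈ F, IsOddCycleEdgeSet G C) ∧
  (∀ C ∈ F, ∀ D ∈ F, C ≠ D → Disjoint (edgeVerts C) (edgeVerts D)) ∧
  (∀ e : Sym2 V, x e = 1 / 2 ↔ ∃ C ∈ F, e ∈ C)

/-- A basic fractional matching of `G`. -/
def IsBasic (G : SimpleGraph V) (x : Sym2 V → ℝ) : Prop :=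
  IsFracMatching G x ∧ IsHalfIntegral x ∧ ∃ F, IsCycleFamily G x F

/-- γ(G): the minimum number of odd cycles in the support of a basic
maximum-weight fractional matching of `G`. -/
noncomputable def gamma (G : SimpleGraph V) (w : Sym2 V → ℝ) : ℕ :=
  sInf {n : ℕ | ∃ (x : Sym2 V → ℝ) (F : Finset (Finset (Sym2 V))),
    IsMaxFracMatching G w x ∧ IsHalfIntegral x ∧ IsCycleFamily G x F ∧ F.card = n}

/-- `G` is stable: ν(G) = ν_f(G). -/
def IsStable (G : SimpleGraph V) (w : Sym2 V → ℝ) : Prop := nu G w = nuf G w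

/-- Deletion of a set of vertices (as the spanning subgraph obtained by
removing all edges incident to `S`; matchings, fractional matchings and covers
of `G∖S` correspond to those of this graph). -/
def deleteVerts (G : SimpleGraph V) (S : Set V) : SimpleGraph V where
  Adj a b := G.Adj a b ∧ a ∉ S ∧ b ∉ S
  symm := ⟨fun _ _ h => ⟨h.1.symm, h.2.2, h.2.1⟩⟩
  loopless := ⟨fun a h => G.loopless.irrefl a h.1⟩

/-- A fractional w-vertex cover of `G`. -/
def IsFracCover (G : SimpleGraph V) (w : Sym2 V → ℝ) (y : V → ℝ) : Prop :=
  (∀ v, 0 ≤ y v) ∧ ∀ a b : V, G.Adj a b → w s(a, b) ≤ y a + y b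

noncomputable def coverValue (y : V → ℝ) : ℝ := ∑ v : V, y v

/-- A minimum fractional w-vertex cover of `G`. -/
def IsMinFracCover (G : SimpleGraph V) (w : Sym2 V → ℝ) (y : V → ℝ) : Prop :=
  IsFracCover G w y ∧ ∀ z : V → ℝ, IsFracCover G w z → coverValue y ≤ coverValue z

/-- M(x): the 1-valued edges of `x`. -/
noncomputable def oneEdges (x : Sym2 V → ℝ) : Finset (Sym2 V) :=
  Finset.univ.filter fun e => x e = 1

/-- `v` is exposed by the matching `M`. -/
def MExposed (M : Finset (Sym2 V)) (v : V) : Prop := ∀ e ∈ M, v ∉ e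

/-- A list of edges alternately in and out of `M`. -/
def AltList (M : Finset (Sym2 V)) (l : List (Sym2 V)) : Prop :=
  l.Chain' fun e f => (e ∈ M ↔ f ∉ M)

variable {G : SimpleGraph V}

/-- An M-alternating walk. -/
def IsAltWalk (M : Finset (Sym2 V)) {a b : V} (p : G.Walk a b) : Prop := AltList M p.edges

/-- A valid walk: it starts (resp. ends) with an M-exposed vertex or an edge of `M`. -/
def IsValidWalk (M : Finset (Sym2 V)) {a b : V} (p : G.Walk a b) : Prop :=
  (MExposed M a ∨ ∃ e ∈ M, p.edges.head? = some e) ∧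
  (MExposed M b ∨ ∃ e ∈ M, p.edges.getLast? = some e)

/-- w(P ∩ M), with multiplicity. -/
noncomputable def wIn (w : Sym2 V → ℝ) (M : Finset (Sym2 V)) (l : List (Sym2 V)) : ℝ :=
  (l.map fun e => if e ∈ M then w e else 0).sum

/-- w(P ∖ M), with multiplicity. -/
noncomputable def wOut (w : Sym2 V → ℝ) (M : Finset (Sym2 V)) (l : List (Sym2 V)) : ℝ :=
  (l.map fun e => if e ∈ M then 0 else w e).sum

/-- An M-augmenting walk. -/
def IsAugWalk (w : Sym2 V → ℝ) (M : Finset (Sym2 V)) {a b : V} (p : G.Walk a b) : Prop :=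
  IsAltWalk M p ∧ IsValidWalk M p ∧ wIn w M p.edges < wOut w M p.edges

/-- An M-augmenting path. -/
def IsAugPath (w : Sym2 V → ℝ) (M : Finset (Sym2 V)) {a b : V} (p : G.Walk a b) : Prop :=
  p.IsPath ∧ IsAugWalk w M p

/-- An M-alternating cycle (an even cycle alternately in and out of `M`). -/
def IsAltCycle (M : Finset (Sym2 V)) {a : V} (c : G.Walk a a) : Prop :=
  c.IsCycle ∧ Even c.length ∧ AltList M c.edges ∧
  ∀ e f : Sym2 V, c.edges.head? = some e → c.edges.getLast? = some f → (e ∈ M ↔ f ∉ M)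

/-- An M-augmenting cycle. -/
def IsAugCycle (w : Sym2 V → ℝ) (M : Finset (Sym2 V)) {a : V} (c : G.Walk a a) : Prop :=
  IsAltCycle M c ∧ wIn w M c.edges < wOut w M c.edges

/-- An M-blossom with base `a` (traversed starting and ending at its base). -/
def IsBlossom (M : Finset (Sym2 V)) {a : V} (c : G.Walk a a) : Prop :=
  c.IsCycle ∧ Odd c.length ∧ AltList M c.edges ∧
  ∀ e : Sym2 V, c.edges.head? = some e → e ∉ M

/-- An M-flower: an M-blossom `c` with base `a` together with a valid M-alternating
path `p` from the base `a` to the root `r`, starting with an edge of `M`. -/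
def IsFlower (M : Finset (Sym2 V)) {a r : V} (c : G.Walk a a) (p : G.Walk a r) : Prop :=
  IsBlossom M c ∧ p.IsPath ∧ AltList M p.edges ∧
  (∃ e ∈ M, p.edges.head? = some e) ∧
  (MExposed M r ∨ ∃ e ∈ M, p.edges.getLast? = some e)

/-- An M-augmenting flower (with root `r`). -/
def IsAugFlower (w : Sym2 V → ℝ) (M : Finset (Sym2 V)) {a r : V}
    (c : G.Walk a a) (p : G.Walk a r) : Prop :=
  IsFlower M c p ∧
  wIn w M c.edges + 2 * wIn w M p.edges < wOut w M c.edges + 2 * wOut w M p.edges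

/-- An M-bi-cycle: two M-blossoms `c`, `d` with bases `a`, `b` joined by an odd
M-alternating path `p` starting and ending with edges of `M`. -/
def IsBicycle (M : Finset (Sym2 V)) {a b : V}
    (c : G.Walk a a) (p : G.Walk a b) (d : G.Walk b b) : Prop :=
  IsBlossom M c ∧ IsBlossom M d ∧ p.IsPath ∧ Odd p.length ∧ AltList M p.edges ∧
  (∃ e ∈ M, p.edges.head? = some e) ∧ (∃ e ∈ M, p.edges.getLast? = some e)

/-- An M-augmenting bi-cycle. -/
def IsAugBicycle (w : Sym2 V → ℝ) (M : Finset (Sym2 V)) {a b : V}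
    (c : G.Walk a a) (p : G.Walk a b) (d : G.Walk b b) : Prop :=
  IsBicycle M c p d ∧
  wIn w M c.edges + 2 * wIn w M p.edges + wIn w M d.edges <
    wOut w M c.edges + 2 * wOut w M p.edges + wOut w M d.edges

/-- All edges of the walk are tight with respect to the fractional vertex cover `y`. -/
def IsTightWalk (w : Sym2 V → ℝ) (y : V → ℝ) {a b : V} (p : G.Walk a b) : Prop :=
  ∀ d ∈ p.darts, y d.toProd.1 + y d.toProd.2 = w s(d.toProd.1, d.toProd.2)

/-- `x'` is the result of alternate rounding on the odd cycle with edge set `C`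
at the vertex `u`: on `C` it is 0/1-valued, both edges of `C` at `u` get value 0,
and its 1-valued edges inside `C` perfectly match the remaining vertices of `C`. -/
def AltRoundedOn (x' : Sym2 V → ℝ) (C : Finset (Sym2 V)) (u : V) : Prop :=
  (∀ e ∈ C, x' e = 0 ∨ x' e = 1) ∧ (∀ e ∈ C, u ∈ e → x' e = 0) ∧
  ∀ z ∈ edgeVerts C, z ≠ u → ∃! e : Sym2 V, e ∈ C ∧ x' e = 1 ∧ z ∈ e

/-- The sum of a function over the two ends of an edge. -/
def endSum {V R : Type*} [AddCommMagma R] (p : V → R) : Sym2 V → R :=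
  Sym2.lift ⟨fun a b => p a + p b, fun _ _ => add_comm _ _⟩

@[simp] lemma endSum_mk {V R : Type*} [AddCommMagma R] (p : V → R) (a b : V) :
    endSum p s(a, b) = p a + p b := rfl

lemma sum_sum_mk_eq_two_mul_sum (h : Sym2 V → ℝ) (h0 : ∀ v, h s(v, v) = 0) :
    ∑ v, ∑ u, h s(v, u) = 2 * ∑ e, h e := by
  rw [← Fintype.sum_prod_type' (fun v u => h s(v, u)),
    ← Finset.sum_fiberwise (s := Finset.univ) (g := fun p : V × V => s(p.1, p.2)), Finset.mul_sum]
  refine Finset.sum_congr rfl fun e _ => ?_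
  induction e with | _ a b
  by_cases hab : a = b
  · subst hab
    rw [h0, mul_zero]
    refine Finset.sum_eq_zero fun p hp => ?_
    rw [(Finset.mem_filter.1 hp).2, h0]
  · have : (Finset.univ.filter fun p : V × V => s(p.1, p.2) = s(a, b)) = {(a, b), (b, a)} := by
      ext ⟨c, d⟩
      simp
    rw [this, Finset.sum_pair (by simp [hab]), Sym2.eq_swap (a := b)]
    ring

lemma sum_mul_load_eq (x : Sym2 V → ℝ) (h0 : ∀ v, x s(v, v) = 0) (p : V → ℝ) :
    ∑ v, p v * ∑ u, x s(v, u) = ∑ e, x e * endSum p e := by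
  have h1 := sum_sum_mk_eq_two_mul_sum (fun e => x e * endSum p e) (by simp [h0])
  have h2 : ∑ v, ∑ u, x s(v, u) * p u = ∑ v, ∑ u, x s(v, u) * p v := by
    rw [Finset.sum_comm]
    refine Finset.sum_congr rfl fun v _ => Finset.sum_congr rfl fun u _ => ?_
    rw [Sym2.eq_swap]
  simp only [endSum_mk, mul_add, Finset.sum_add_distrib, h2] at h1
  simp only [← Finset.sum_mul] at h1
  simp only [mul_comm (p _)]
  linarith

lemma IsFracMatching.diag_eq_zero {G : SimpleGraph V} {x : Sym2 V → ℝ} (hx : IsFracMatching G x)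
    (v : V) : x s(v, v) = 0 :=
  hx.2.1 _ (by simp)

lemma IsFracMatching.mul_le_mul_endSum {G : SimpleGraph V} {w x : Sym2 V → ℝ} {y : V → ℝ}
    (hx : IsFracMatching G x) (hy : IsFracCover G w y) (e : Sym2 V) :
    w e * x e ≤ x e * endSum y e := by
  by_cases he : e ∈ G.edgeSet
  · rw [mul_comm]
    refine mul_le_mul_of_nonneg_left ?_ (hx.1 e)
    induction e with | _ a b
    exact hy.2 a b he
  · simp [hx.2.1 e he]

lemma IsFracMatching.mul_load_le {G : SimpleGraph V} {w x : Sym2 V → ℝ} {y : V → ℝ}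
    (hx : IsFracMatching G x) (hy : IsFracCover G w y) (v : V) :
    y v * ∑ u, x s(v, u) ≤ y v :=
  mul_le_of_le_one_right (hy.1 v) (hx.2.2 v)

lemma fracWeight_le_coverValue {G : SimpleGraph V} {w x : Sym2 V → ℝ} {y : V → ℝ}
    (hx : IsFracMatching G x) (hy : IsFracCover G w y) : fracWeight w x ≤ coverValue y := by
  refine (Finset.sum_le_sum fun e _ => hx.mul_le_mul_endSum hy e).trans ?_
  rw [← sum_mul_load_eq x hx.diag_eq_zero]
  exact Finset.sum_le_sum fun v _ => hx.mul_load_le hy v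

/-- Complementary slackness. -/
lemma slackness {G : SimpleGraph V} {w x : Sym2 V → ℝ} {y : V → ℝ}
    (hx : IsFracMatching G x) (hy : IsFracCover G w y) (h : fracWeight w x = coverValue y) :
    (∀ e, x e ≠ 0 → w e = endSum y e) ∧ ∀ v, y v ≠ 0 → ∑ u, x s(v, u) = 1 := by
  have h1 : ∑ e, w e * x e ≤ ∑ e, x e * endSum y e :=
    Finset.sum_le_sum fun e _ => hx.mul_le_mul_endSum hy e
  have h2 : ∑ v, y v * ∑ u, x s(v, u) ≤ ∑ v, y v := Finset.sum_le_sum fun v _ => hx.mul_load_le hy v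
  have h3 := sum_mul_load_eq x hx.diag_eq_zero y
  unfold fracWeight coverValue at h
  constructor
  · intro e he
    have := (Finset.sum_eq_sum_iff_of_le fun e _ => hx.mul_le_mul_endSum hy e).1
      (le_antisymm h1 (by linarith)) e (Finset.mem_univ _)
    rw [mul_comm] at this
    exact mul_left_cancel₀ he this
  · intro v hv
    have := (Finset.sum_eq_sum_iff_of_le fun v _ => hx.mul_load_le hy v).1
      (le_antisymm h2 (by linarith)) v (Finset.mem_univ _)
    exact mul_left_cancel₀ hv (this.trans (mul_one _).symm)

lemma IsFracMatching.add_le_one {G : SimpleGraph V} {x : Sym2 V → ℝ} (hx : IsFracMatching G x)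
    {e f : Sym2 V} (hef : e ≠ f) {v : V} (he : v ∈ e) (hf : v ∈ f) : x e + x f ≤ 1 := by
  obtain ⟨a, rfl⟩ := Sym2.mem_iff_exists.1 he
  obtain ⟨b, rfl⟩ := Sym2.mem_iff_exists.1 hf
  have hab : a ≠ b := fun h => hef (h ▸ rfl)
  refine le_trans ?_ (hx.2.2 v)
  rw [← Finset.sum_pair (f := fun u => x s(v, u)) hab]
  exact Finset.sum_le_sum_of_subset_of_nonneg (Finset.subset_univ _) fun _ _ _ => hx.1 _

lemma IsFracMatching.le_one {G : SimpleGraph V} {x : Sym2 V → ℝ} (hx : IsFracMatching G x)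
    (e : Sym2 V) : x e ≤ 1 := by
  induction e with | _ a b
  exact (Finset.single_le_sum (f := fun u => x s(a, u)) (fun _ _ => hx.1 _)
    (Finset.mem_univ b)).trans (hx.2.2 a)

lemma sum_update_mul {ι : Type*} [Fintype ι] [DecidableEq ι] (b c : ι → ℝ) (i : ι) (t : ℝ) :
    ∑ j, Function.update b i t j * c j = ∑ j, b j * c j + (t - b i) * c i := by
  have : ∀ j, Function.update b i t j * c j =
      b j * c j + if j = i then (t - b i) * c i else 0 := by
    intro j
    by_cases h : j = i
    · subst h
      simp
      ring
    · simp [h]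
  simp [this, Finset.sum_add_distrib]

/-- Linear programming duality for fractional matchings. -/
lemma exists_fracWeight_eq_coverValue (G : SimpleGraph V) (w : Sym2 V → ℝ) :
    ∃ x y, IsFracMatching G x ∧ IsFracCover G w y ∧ fracWeight w x = coverValue y := by
  classical
  set C : ℝ := 1 + ∑ e, |w e| with hC
  have hwC : ∀ e, w e < C := fun e => by
    have := Finset.single_le_sum (f := fun e => |w e|) (fun _ _ => abs_nonneg _) (Finset.mem_univ e)
    have := le_abs_self (w e)
    linarith
  have hC0 : 0 ≤ C := by positivity
  let top : Sym2 V → ℝ := fun e => if e ∈ G.edgeSet then 2 else 0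
  have htop : ∀ e, 0 ≤ top e := fun e => by unfold top; split <;> norm_num
  have htopd : ∀ v, top s(v, v) = 0 := fun v => by simp [top]
  let X : Set (V → ℝ) := Set.Icc 0 fun _ => C
  let Y : Set (Sym2 V → ℝ) := Set.Icc 0 top
  let f : (V → ℝ) → (Sym2 V → ℝ) → ℝ := fun y x =>
    ∑ e, w e * x e + ∑ v, y v * (1 - ∑ u, x s(v, u))
  have hYd : ∀ x ∈ Y, ∀ v, x s(v, v) = 0 := fun x hx v =>
    le_antisymm ((hx.2 _).trans_eq (htopd v)) (hx.1 _)
  have hf : ∀ y, ∀ x ∈ Y, f y x = ∑ e, x e * (w e - endSum y e) + ∑ v, y v := by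
    intro y x hx
    have := sum_mul_load_eq x (hYd x hx) y
    simp only [f, mul_sub, mul_one, Finset.sum_sub_distrib, this, mul_comm (w _)]
    ring
  obtain ⟨a, ha, b, hb, hab⟩ : ∃ a ∈ X, ∃ b ∈ Y, IsSaddlePointOn X Y f a b := by
    refine Sion.exists_isSaddlePointOn ⟨0, by simp [X, Pi.le_def, hC0]⟩ (convex_Icc _ _) isCompact_Icc
      ?_ ?_ (convex_Icc _ _) ⟨0, by simp [Y, Pi.le_def, htop]⟩ isCompact_Icc ?_ ?_
    · intro x _
      exact (Continuous.continuousOn (by fun_prop)).lowerSemicontinuousOn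
    · intro x _
      refine ConvexOn.quasiconvexOn ⟨convex_Icc _ _, fun y₁ _ y₂ _ s t _ _ hst => le_of_eq ?_⟩
      simp only [f, Pi.add_apply, Pi.smul_apply, smul_eq_mul, add_mul, Finset.sum_add_distrib,
        mul_assoc, mul_add, ← Finset.mul_sum]
      linear_combination (-(∑ e, w e * x e)) * hst
    · intro x _
      exact (Continuous.continuousOn (by fun_prop)).upperSemicontinuousOn
    · intro y _
      refine ConcaveOn.quasiconcaveOn ⟨convex_Icc _ _, fun x₁ h₁ x₂ h₂ s t hs ht hst => le_of_eq ?_⟩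
      show s * f y x₁ + t * f y x₂ = f y (s • x₁ + t • x₂)
      rw [hf y _ (convex_Icc _ _ h₁ h₂ hs ht hst), hf y _ h₁, hf y _ h₂]
      simp only [Pi.add_apply, Pi.smul_apply, smul_eq_mul, add_mul, Finset.sum_add_distrib,
        mul_assoc, mul_add, ← Finset.mul_sum]
      linear_combination (∑ v, y v) * hst
  have hup : ∀ e t, 0 ≤ t → t ≤ top e → t * (w e - endSum a e) ≤ b e * (w e - endSum a e) := by
    intro e t h0 ht
    have hmem : Function.update b e t ∈ Y := by
      constructor
      · intro e'
        by_cases h : e' = e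
        · subst h; simpa using h0
        · simpa [h] using hb.1 e'
      · intro e'
        by_cases h : e' = e
        · subst h; simpa using ht
        · simpa [h] using hb.2 e'
    have := hab a ha _ hmem
    rw [hf _ _ hmem, hf _ _ hb, sum_update_mul] at this
    linarith
  have hload : ∀ v, ∑ u, b s(v, u) ≤ 1 := by
    intro v
    by_contra! hv
    have hmem : Function.update a v C ∈ X := by
      constructor
      · intro u
        by_cases h : u = v
        · subst h; simpa using hC0
        · simpa [h] using ha.1 u
      · intro u
        by_cases h : u = v
        · subst h; simp
        · simpa [h] using ha.2 u
    have := hab _ hmem _ hb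
    simp only [f] at this
    rw [sum_update_mul] at this
    have hav : C ≤ a v := by nlinarith
    have : ∑ u, b s(v, u) = 0 := by
      refine Finset.sum_eq_zero fun u _ => ?_
      have h1 := hup s(v, u) 0 le_rfl (htop _)
      have h2 := hwC s(v, u)
      have h3 : 0 ≤ a u := ha.1 u
      have h4 : 0 ≤ b s(v, u) := hb.1 _
      rw [endSum_mk] at h1
      nlinarith
    linarith
  have hbm : IsFracMatching G b :=
    ⟨hb.1, fun e he => le_antisymm ((hb.2 e).trans_eq (by simp [top, he])) (hb.1 e), hload⟩
  have hac : IsFracCover G w a := by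
    refine ⟨ha.1, fun u v huv => ?_⟩
    by_contra! h
    have := hup s(u, v) 2 (by norm_num) (by simp [top, huv])
    rw [endSum_mk] at this
    have := hbm.le_one s(u, v)
    nlinarith
  refine ⟨b, a, hbm, hac, le_antisymm (fracWeight_le_coverValue hbm hac) ?_⟩
  have h0X : (0 : V → ℝ) ∈ X := by simp [X, Pi.le_def, hC0]
  have h0Y : (0 : Sym2 V → ℝ) ∈ Y := by simp [Y, Pi.le_def, htop]
  simpa [f, fracWeight, coverValue] using hab 0 h0X 0 h0Y

/-- A permutation moving each vertex along an edge of `G`, if at all. -/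
def IsEdgePerm (G : SimpleGraph V) (σ : Equiv.Perm V) : Prop := ∀ v, σ v = v ∨ G.Adj v (σ v)

/-- The half-integral vector giving value `1 / 2` to each arc `(v, σ v)` with `σ v ≠ v`. -/
noncomputable def permFrac (σ : Equiv.Perm V) : Sym2 V → ℝ :=
  Sym2.lift ⟨fun a b => if a = b then 0 else
    ((if σ a = b then 1 else 0) + if σ b = a then 1 else 0) / 2, fun a b => by
      simp only [eq_comm (a := a) (b := b), add_comm]⟩

lemma permFrac_mk (σ : Equiv.Perm V) (a b : V) : permFrac σ s(a, b) = if a = b then 0 else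
    ((if σ a = b then 1 else 0) + if σ b = a then 1 else 0) / 2 := rfl

lemma isHalfIntegral_permFrac (σ : Equiv.Perm V) : IsHalfIntegral (permFrac σ) := by
  intro e
  induction e with | _ a b
  rw [permFrac_mk]
  split_ifs <;> norm_num

lemma IsEdgePerm.isFracMatching {G : SimpleGraph V} {σ : Equiv.Perm V} (h : IsEdgePerm G σ) :
    IsFracMatching G (permFrac σ) := by
  refine ⟨fun e => ?_, fun e he => ?_, fun v => ?_⟩
  · rcases isHalfIntegral_permFrac σ e with h | h | h <;> rw [h] <;> norm_num
  · induction e with | _ a b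
    rw [permFrac_mk]
    split_ifs with h1 h2 h3 h3
    · rfl
    · exact absurd (h2 ▸ (h a).resolve_left (by rw [h2]; exact Ne.symm h1)) he
    · exact absurd (h2 ▸ (h a).resolve_left (by rw [h2]; exact Ne.symm h1)) he
    · exact absurd (h3 ▸ (h b).resolve_left (by rw [h3]; exact h1)).symm he
    · simp
  · have h1 : ∀ u, permFrac σ s(v, u) ≤
        ((if σ v = u then 1 else 0) + if u = σ.symm v then 1 else 0) / 2 := by
      intro u
      simp only [permFrac_mk, Equiv.eq_symm_apply]
      split_ifs <;> norm_num
    refine (Finset.sum_le_sum fun u _ => h1 u).trans ?_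
    rw [← Finset.sum_div, Finset.sum_add_distrib]
    simp

lemma exists_isEdgePerm_isMaxFracMatching (G : SimpleGraph V) (w : Sym2 V → ℝ) :
    ∃ σ : Equiv.Perm V, IsEdgePerm G σ ∧ IsMaxFracMatching G w (permFrac σ) := by
  obtain ⟨x, y, hx, hy, hxy⟩ := exists_fracWeight_eq_coverValue G w
  let A : Matrix V V ℝ := fun a b => x s(a, b) + if a = b then 1 - ∑ u, x s(a, u) else 0
  have hA : A ∈ doublyStochastic ℝ V := by
    rw [mem_doublyStochastic_iff_sum]
    refine ⟨fun a b => ?_, fun a => ?_, fun b => ?_⟩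
    · have := hx.1 s(a, b)
      have := hx.2.2 a
      simp only [A]
      split_ifs <;> linarith
    · simp [A, Finset.sum_add_distrib]
    · simp [A, Finset.sum_add_distrib, Sym2.eq_swap (b := b)]
  obtain ⟨c, hc0, hc1, hcA⟩ := exists_eq_sum_perm_of_mem_doublyStochastic hA
  have hmk : ∀ a b, a ≠ b → x s(a, b) = ∑ σ, c σ * if σ a = b then 1 else 0 := by
    intro a b hab
    have := congrFun (congrFun hcA a) b
    simp only [A, hab, if_false, add_zero] at this
    rw [← this, Matrix.sum_apply]
    refine Finset.sum_congr rfl fun σ _ => ?_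
    simp [Equiv.Perm.permMatrix, PEquiv.toMatrix_apply, eq_comm]
  have hadm : ∀ σ, c σ ≠ 0 → IsEdgePerm G σ := by
    intro σ hσ v
    by_contra! h
    have h1 := hmk v (σ v) h.1.symm
    rw [hx.2.1 _ (by simpa using h.2)] at h1
    have := (Finset.sum_eq_zero_iff_of_nonneg (fun τ _ => mul_nonneg (hc0 τ) (by positivity))).1
      h1.symm σ (Finset.mem_univ _)
    simp [hσ] at this
  have hxc : ∀ e, x e = ∑ σ, c σ * permFrac σ e := by
    intro e
    induction e with | _ a b
    by_cases hab : a = b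
    · subst hab
      simp [permFrac_mk, hx.diag_eq_zero]
    · have h1 := hmk a b hab
      have h2 := hmk b a (Ne.symm hab)
      rw [Sym2.eq_swap] at h2
      simp only [permFrac_mk, hab, if_false, mul_div_assoc', mul_add, ← Finset.sum_div,
        Finset.sum_add_distrib, ← h1, ← h2]
      ring
  have hw : fracWeight w x = ∑ σ, c σ * fracWeight w (permFrac σ) := by
    simp only [fracWeight, hxc, Finset.mul_sum]
    rw [Finset.sum_comm]
    refine Finset.sum_congr rfl fun σ _ => Finset.sum_congr rfl fun e _ => by ring
  obtain ⟨σ, hσ, hle⟩ : ∃ σ, c σ ≠ 0 ∧ fracWeight w x ≤ fracWeight w (permFrac σ) := by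
    by_contra! h
    have h1 : ∑ σ, c σ * fracWeight w (permFrac σ) < ∑ σ, c σ * fracWeight w x := by
      obtain ⟨σ, -, hσ⟩ : ∃ σ ∈ Finset.univ, c σ ≠ 0 :=
        Finset.exists_ne_zero_of_sum_ne_zero (by rw [hc1]; exact one_ne_zero)
      refine Finset.sum_lt_sum (fun τ _ => ?_) ⟨σ, Finset.mem_univ _, ?_⟩
      · by_cases hτ : c τ = 0
        · simp [hτ]
        · exact mul_le_mul_of_nonneg_left (h τ hτ).le (hc0 τ)
      · exact mul_lt_mul_of_pos_left (h σ hσ) ((hc0 σ).lt_of_ne' hσ)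
    rw [← Finset.sum_mul, hc1, one_mul, ← hw] at h1
    exact lt_irrefl _ h1
  exact ⟨σ, hadm σ hσ, (hadm σ hσ).isFracMatching, fun z hz =>
    ((fracWeight_le_coverValue hz hy).trans_eq hxy.symm).trans hle⟩

open Classical in
/-- The permutation obtained from `σ` by turning the arcs from `A` to `σ A` into transpositions,
for a set `A` that is stable under `σ ∘ σ` and disjoint from `σ A`. -/
noncomputable def flipPerm (σ : Equiv.Perm V) (A : Set V) (h1 : ∀ u ∈ A, σ u ∉ A)
    (h2 : ∀ u, σ (σ u) ∈ A ↔ u ∈ A) : Equiv.Perm V where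
  toFun u := if u ∈ A then σ u else if σ.symm u ∈ A then σ.symm u else σ u
  invFun u := if u ∈ A then σ u else σ.symm u
  left_inv u := by
    have := h2 (σ.symm u)
    simp only [Equiv.apply_symm_apply] at this
    by_cases hu : u ∈ A
    · simp [hu, h1 u hu]
    · by_cases hu' : σ.symm u ∈ A
      · simp [hu, hu']
      · simp [hu, hu', this]
  right_inv u := by
    have h3 := h2 (σ.symm (σ.symm u))
    simp only [Equiv.apply_symm_apply] at h3
    by_cases hu : u ∈ A
    · simp [hu, h1 u hu]
    · by_cases hu' : σ.symm u ∈ A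
      · simp [hu, hu']
      · simp [hu, hu', ← h3]

lemma flipPerm_apply_of_mem {σ : Equiv.Perm V} {A : Set V} (h1 : ∀ u ∈ A, σ u ∉ A)
    (h2 : ∀ u, σ (σ u) ∈ A ↔ u ∈ A) {u : V} (hu : u ∈ A) : flipPerm σ A h1 h2 u = σ u := by
  simp [flipPerm, hu]

lemma flipPerm_apply_of_symm_mem {σ : Equiv.Perm V} {A : Set V} (h1 : ∀ u ∈ A, σ u ∉ A)
    (h2 : ∀ u, σ (σ u) ∈ A ↔ u ∈ A) {u : V} (hu : σ.symm u ∈ A) :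
    flipPerm σ A h1 h2 u = σ.symm u := by
  have : u ∉ A := by simpa using h1 _ hu
  simp [flipPerm, hu, this]

lemma flipPerm_apply_of_not_mem {σ : Equiv.Perm V} {A : Set V} (h1 : ∀ u ∈ A, σ u ∉ A)
    (h2 : ∀ u, σ (σ u) ∈ A ↔ u ∈ A) {u : V} (hu : σ.symm u ∉ A) :
    flipPerm σ A h1 h2 u = σ u := by
  simp [flipPerm, hu]

lemma isEdgePerm_flipPerm {G : SimpleGraph V} {σ : Equiv.Perm V} (hσ : IsEdgePerm G σ) {A : Set V}
    (h1 : ∀ u ∈ A, σ u ∉ A) (h2 : ∀ u, σ (σ u) ∈ A ↔ u ∈ A) :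
    IsEdgePerm G (flipPerm σ A h1 h2) := by
  intro u
  by_cases hu : σ.symm u ∈ A
  · rw [flipPerm_apply_of_symm_mem h1 h2 hu]
    have := hσ (σ.symm u)
    rw [Equiv.apply_symm_apply] at this
    exact this.imp Eq.symm SimpleGraph.Adj.symm
  · rw [flipPerm_apply_of_not_mem h1 h2 hu]
    exact hσ u

lemma flipPerm_flipPerm_ne_iff {σ : Equiv.Perm V} {A : Set V}
    (h1 : ∀ u ∈ A, σ u ∉ A) (h2 : ∀ u, σ (σ u) ∈ A ↔ u ∈ A) (u : V) :
    flipPerm σ A h1 h2 (flipPerm σ A h1 h2 u) ≠ u ↔ u ∉ A ∧ σ u ∉ A ∧ σ (σ u) ≠ u := by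
  by_cases hu : u ∈ A
  · rw [flipPerm_apply_of_mem h1 h2 hu, flipPerm_apply_of_symm_mem h1 h2 (by simpa using hu)]
    simp [hu]
  · by_cases hu' : σ.symm u ∈ A
    · rw [flipPerm_apply_of_symm_mem h1 h2 hu', flipPerm_apply_of_mem h1 h2 hu']
      have := h2 (σ.symm u)
      rw [Equiv.apply_symm_apply] at this
      simp [this, hu']
    · have := h2 (σ.symm u)
      rw [Equiv.apply_symm_apply] at this
      rw [flipPerm_apply_of_not_mem h1 h2 hu', flipPerm_apply_of_not_mem h1 h2 (by simpa using hu)]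
      simp [this, hu, hu']

lemma exists_isEdgePerm_sameCycle (G : SimpleGraph V) (w : Sym2 V → ℝ) :
    ∃ σ : Equiv.Perm V, IsEdgePerm G σ ∧ IsMaxFracMatching G w (permFrac σ) ∧
      ∀ v, σ (σ v) ≠ v → (σ * σ).SameCycle v (σ v) := by
  have hex := exists_isEdgePerm_isMaxFracMatching G w
  obtain ⟨σ, ⟨hσ, hmax⟩, hmin⟩ := Set.exists_min_image
    {σ : Equiv.Perm V | IsEdgePerm G σ ∧ IsMaxFracMatching G w (permFrac σ)}
    (fun σ => (Finset.univ.filter fun v => σ (σ v) ≠ v).card) (Set.toFinite _) hex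
  refine ⟨σ, hσ, hmax, fun v hv => ?_⟩
  by_contra hcyc
  let A : Set V := {u | (σ * σ).SameCycle v u}
  have h2 : ∀ u, σ (σ u) ∈ A ↔ u ∈ A := fun u => Equiv.Perm.sameCycle_apply_right (f := σ * σ)
  have hcomm : ∀ n : ℤ, ∀ u, ((σ * σ) ^ n) (σ u) = σ (((σ * σ) ^ n) u) := fun n u => by
    have : Commute ((σ * σ) ^ n) σ := ((Commute.refl σ).mul_left (Commute.refl σ)).zpow_left n
    exact congrArg (fun f : Equiv.Perm V => f u) this.eq
  have h1 : ∀ u ∈ A, σ u ∉ A := by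
    intro u hu hu'
    refine hcyc (hu'.trans ?_)
    obtain ⟨n, rfl⟩ := hu.symm
    exact ⟨n, hcomm n u⟩
  let B : Set V := {u | σ u ∈ A}
  have h1' : ∀ u ∈ B, σ u ∉ B := fun u hu hu' => h1 _ hu hu'
  have h2' : ∀ u, σ (σ u) ∈ B ↔ u ∈ B := fun u => h2 (σ u)
  have hsum : ∀ e, permFrac (flipPerm σ A h1 h2) e + permFrac (flipPerm σ B h1' h2') e =
      permFrac σ e + permFrac σ e := by
    intro e
    induction e with | _ a b
    have key : ∀ a b, (((if flipPerm σ A h1 h2 a = b then 1 else 0) : ℝ) +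
        if flipPerm σ B h1' h2' a = b then 1 else 0) = if a ∈ A ∨ a ∈ B then
          (if σ a = b then 1 else 0) + (if σ b = a then 1 else 0) else
          (if σ a = b then 1 else 0) + if σ a = b then 1 else 0 := by
      intro a b
      have hs : ∀ u, σ.symm u ∈ A ↔ u ∈ B := fun u => by
        have := h2 (σ.symm u)
        rw [Equiv.apply_symm_apply] at this
        exact this.symm
      have hs' : ∀ u, σ.symm u ∈ B ↔ u ∈ A := fun u => by simp [B]
      by_cases ha : a ∈ A
      · rw [flipPerm_apply_of_mem h1 h2 ha, flipPerm_apply_of_symm_mem h1' h2' ((hs' a).2 ha)]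
        simp [ha, Equiv.symm_apply_eq, eq_comm (a := a)]
      · by_cases hb : a ∈ B
        · rw [flipPerm_apply_of_mem h1' h2' hb, flipPerm_apply_of_symm_mem h1 h2 ((hs a).2 hb)]
          simp [hb, Equiv.symm_apply_eq, eq_comm (a := a), add_comm]
        · rw [flipPerm_apply_of_not_mem h1' h2' (mt (hs' a).1 ha),
            flipPerm_apply_of_not_mem h1 h2 (mt (hs a).1 hb)]
          simp [ha, hb]
    simp only [permFrac_mk]
    by_cases hab : a = b
    · simp [hab]
    have hk := key a b
    have hk' := key b a
    simp only [hab, if_false]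
    have hAB : σ a = b ∨ σ b = a → (a ∈ A ∨ a ∈ B ↔ b ∈ A ∨ b ∈ B) := by
      rintro (rfl | rfl)
      · exact or_comm.trans (or_congr Iff.rfl (h2 a).symm)
      · exact (or_comm.trans (or_congr Iff.rfl (h2 b).symm)).symm
    by_cases h : σ a = b ∨ σ b = a
    · simp only [hAB h] at hk
      split_ifs at hk hk' ⊢ <;> linarith
    · push Not at h
      simp only [h.1, h.2, if_false, add_zero, ite_self] at hk hk' ⊢
      linarith
  have hw : fracWeight w (permFrac (flipPerm σ A h1 h2)) +
      fracWeight w (permFrac (flipPerm σ B h1' h2')) =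
      fracWeight w (permFrac σ) + fracWeight w (permFrac σ) := by
    simp only [fracWeight, ← Finset.sum_add_distrib, ← mul_add, hsum]
  have hA := isEdgePerm_flipPerm hσ h1 h2
  have hle := hmax.2 _ (isEdgePerm_flipPerm hσ h1' h2').isFracMatching
  have hAmax : IsMaxFracMatching G w (permFrac (flipPerm σ A h1 h2)) :=
    ⟨hA.isFracMatching, fun z hz => (hmax.2 z hz).trans (by linarith)⟩
  refine absurd (hmin _ ⟨hA, hAmax⟩) (not_le.2 (Finset.card_lt_card ?_))
  simp only [flipPerm_flipPerm_ne_iff]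
  refine Finset.ssubset_iff_of_subset (fun u hu => ?_) |>.2 ⟨v, by simpa using hv, ?_⟩
  · simp only [Finset.mem_filter, Finset.mem_univ, true_and] at hu ⊢
    exact hu.2.2
  · simp [A, Equiv.Perm.SameCycle.refl]

lemma IsEdgePerm.exists_walk {G : SimpleGraph V} {σ : Equiv.Perm V} (hσ : IsEdgePerm G σ) (k : ℕ) :
    ∀ u v, σ u ≠ u → σ^[k] u = v → ∃ p : G.Walk u v, p.support = List.iterate σ u (k + 1) ∧
      p.edges = (List.iterate σ u k).map fun u => s(u, σ u) := by
  induction k with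
  | zero =>
    rintro u v - rfl
    exact ⟨.nil, rfl, rfl⟩
  | succ k ih =>
    rintro u v hu hv
    obtain ⟨p, hp, hp'⟩ := ih (σ u) v (by simpa using hu) hv
    exact ⟨.cons ((hσ u).resolve_left hu) p, by simp [hp, List.iterate], by simp [hp', List.iterate]⟩

/-- The edges joining consecutive vertices of the orbit of `v` under `σ`. -/
def orbitEdges (σ : Equiv.Perm V) (v : V) : Finset (Sym2 V) :=
  open Classical in (Finset.univ.filter fun u => σ.SameCycle v u).image fun u => s(u, σ u)

lemma mem_orbitEdges {σ : Equiv.Perm V} {v : V} {e : Sym2 V} :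
    e ∈ orbitEdges σ v ↔ ∃ u, σ.SameCycle v u ∧ s(u, σ u) = e := by
  simp [orbitEdges]

lemma mem_edgeVerts_orbitEdges {σ : Equiv.Perm V} {v u : V} :
    u ∈ edgeVerts (orbitEdges σ v) ↔ σ.SameCycle v u := by
  constructor
  · rintro ⟨e, he, hu⟩
    obtain ⟨x, hx, rfl⟩ := mem_orbitEdges.1 he
    rcases Sym2.mem_iff.1 hu with rfl | rfl
    · exact hx
    · exact Equiv.Perm.sameCycle_apply_right.2 hx
  · exact fun h => ⟨_, mem_orbitEdges.2 ⟨u, h, rfl⟩, Sym2.mem_mk_left _ _⟩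

lemma sameCycle_iff_exists_lt_minimalPeriod {σ : Equiv.Perm V} {v u : V} :
    σ.SameCycle v u ↔ ∃ i < Function.minimalPeriod σ v, u = σ^[i] v := by
  constructor
  · intro h
    obtain ⟨i, hi⟩ := h.exists_nat_pow_eq
    refine ⟨i % Function.minimalPeriod σ v, Nat.mod_lt _
      (Function.minimalPeriod_pos_of_mem_periodicPts (σ.injective.mem_periodicPts v)), ?_⟩
    rw [Function.iterate_mod_minimalPeriod_eq, ← Equiv.Perm.coe_pow, hi]
  · rintro ⟨i, -, rfl⟩
    rw [← Equiv.Perm.coe_pow]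
    exact Equiv.Perm.sameCycle_pow_right.2 (Equiv.Perm.SameCycle.refl _ _)

lemma isOddCycleEdgeSet_orbitEdges {G : SimpleGraph V} {σ : Equiv.Perm V} (hσ : IsEdgePerm G σ)
    {v : V} (hv : σ (σ v) ≠ v) (hc : (σ * σ).SameCycle v (σ v)) :
    IsOddCycleEdgeSet G (orbitEdges σ v) := by
  have hv' : σ v ≠ v := fun h => hv (by rw [h, h])
  obtain ⟨n, hn⟩ : ∃ n, Function.minimalPeriod σ v = n + 1 :=
    Nat.exists_eq_succ_of_ne_zero
      (Function.minimalPeriod_pos_of_mem_periodicPts (σ.injective.mem_periodicPts v)).ne'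
  have hper : σ^[n] (σ v) = v := by
    change σ^[n + 1] v = v
    rw [← hn]
    exact Function.iterate_minimalPeriod
  obtain ⟨p, hp, hp'⟩ := hσ.exists_walk n (σ v) v (by simpa using hv') hper
  have hlen : p.length = n := by rw [← p.length_edges, hp']; simp
  refine ⟨v, .cons ((hσ v).resolve_left hv') p, ?_, ?_, ?_⟩
  · rw [SimpleGraph.Walk.cons_isCycle_iff, SimpleGraph.Walk.isPath_def, hp, hp']
    constructor
    · rw [← List.range_map_iterate, List.nodup_map_iff_inj_on List.nodup_range]
      intro i hi j hj hij
      rw [List.mem_range, ← hn] at hi hj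
      simp only [← Function.iterate_succ_apply, Function.iterate_succ_apply'] at hij
      exact Function.iterate_injOn_Iio_minimalPeriod hi hj (σ.injective hij)
    · intro h
      obtain ⟨x, hx, hxe⟩ := List.mem_map.1 h
      obtain ⟨i, hi, rfl⟩ := List.mem_iterate.1 hx
      rcases Sym2.eq_iff.1 hxe with h | h
      · have h3 : σ^[i + 1] v = v := h.1
        have := Function.IsPeriodicPt.minimalPeriod_le (Nat.succ_pos i) h3
        omega
      · exact hv (h.1 ▸ h.2)
  · rw [SimpleGraph.Walk.length_cons, hlen, ← hn]
    by_contra hodd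
    obtain ⟨i, hi⟩ := hc.exists_nat_pow_eq
    have h1 : σ^[2 * i + n] v = v := by
      rw [add_comm, Function.iterate_add_apply, Function.iterate_mul]
      have : (σ^[2])^[i] v = σ v := by rw [← hi, Equiv.Perm.coe_pow]; rfl
      rw [this, hper]
    have h2 := Function.IsPeriodicPt.minimalPeriod_dvd h1
    rw [Nat.not_odd_iff_even] at hodd
    have h3 := hodd.two_dvd
    have h4 := h3.trans h2
    omega
  · ext e
    rw [List.mem_toFinset, mem_orbitEdges, SimpleGraph.Walk.edges_cons, hp']
    have : s(v, σ v) :: List.map (fun u => s(u, σ u)) (List.iterate σ (σ v) n) =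
      List.map (fun u => s(u, σ u)) (List.iterate σ v (n + 1)) := rfl
    rw [this, ← hn]
    simp only [List.mem_map, List.mem_iterate, sameCycle_iff_exists_lt_minimalPeriod]

lemma exists_isCycleFamily_permFrac {G : SimpleGraph V} {σ : Equiv.Perm V} (hσ : IsEdgePerm G σ)
    (hc : ∀ v, σ (σ v) ≠ v → (σ * σ).SameCycle v (σ v)) :
    ∃ C, IsCycleFamily G (permFrac σ) C := by
  refine ⟨(Finset.univ.filter fun v => σ (σ v) ≠ v).image (orbitEdges σ), ?_, ?_, ?_⟩
  · intro C hC
    simp only [Finset.mem_image, Finset.mem_filter, Finset.mem_univ, true_and] at hC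
    obtain ⟨v, hv, rfl⟩ := hC
    exact isOddCycleEdgeSet_orbitEdges hσ hv (hc v hv)
  · intro C hC D hD hCD
    simp only [Finset.mem_image, Finset.mem_filter, Finset.mem_univ, true_and] at hC hD
    obtain ⟨v, hv, rfl⟩ := hC
    obtain ⟨u, hu, rfl⟩ := hD
    rw [Set.disjoint_left]
    intro z hz hz'
    rw [mem_edgeVerts_orbitEdges] at hz hz'
    refine hCD (Finset.ext fun e => ?_)
    have huv : σ.SameCycle v u := hz.trans hz'.symm
    simp only [mem_orbitEdges]
    exact exists_congr fun x => and_congr_left' ⟨huv.symm.trans, huv.trans⟩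
  · intro e
    simp only [Finset.mem_image, Finset.mem_filter, Finset.mem_univ, true_and, exists_exists_and_eq_and,
      mem_orbitEdges]
    constructor
    · intro he
      induction e with | _ a b
      rw [permFrac_mk] at he
      by_cases ha : σ a = b
      · refine ⟨a, fun h => ?_, a, Equiv.Perm.SameCycle.refl _ _, by rw [ha]⟩
        rw [ha] at h
        simp only [ha, h] at he
        split_ifs at he <;> norm_num at he
      · refine ⟨b, fun h => ?_, b, Equiv.Perm.SameCycle.refl _ _, ?_⟩
        · have hb : σ b ≠ a := fun h' => ha (h' ▸ h)
          simp [ha, hb] at he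
        · by_contra h
          have hb : σ b ≠ a := fun h' => h (by rw [h', Sym2.eq_swap])
          simp [ha, hb] at he
    · rintro ⟨v, hv, u, hvu, rfl⟩
      have hu : σ (σ u) ≠ u := by
        obtain ⟨n, rfl⟩ := hvu
        intro h
        apply hv
        apply (σ ^ n).injective
        rw [← h]
        simp only [← Equiv.Perm.mul_apply]
        congr 1
        group
      have hu' : u ≠ σ u := fun h => hu (by rw [← h, ← h])
      simp [permFrac_mk, hu, hu']

lemma exists_basic_isMaxFracMatching (G : SimpleGraph V) (w : Sym2 V → ℝ) :
    ∃ x C, IsMaxFracMatching G w x ∧ IsHalfIntegral x ∧ IsCycleFamily G x C := by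
  obtain ⟨σ, hσ, hmax, hc⟩ := exists_isEdgePerm_sameCycle G w
  obtain ⟨C, hC⟩ := exists_isCycleFamily_permFrac hσ hc
  exact ⟨_, C, hmax, isHalfIntegral_permFrac σ, hC⟩

/-- The 0/1-vector of a set of edges. -/
noncomputable def edgeInd (M : Finset (Sym2 V)) (e : Sym2 V) : ℝ := if e ∈ M then 1 else 0

lemma fracWeight_edgeInd (w : Sym2 V → ℝ) (M : Finset (Sym2 V)) :
    fracWeight w (edgeInd M) = setWeight w M := by
  simp [fracWeight, edgeInd, setWeight]

lemma IsMatching.sum_edgeInd_eq_one {G : SimpleGraph V} {M : Finset (Sym2 V)} (hM : IsMatching G M)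
    {e : Sym2 V} (he : e ∈ M) {v : V} (hv : v ∈ e) : ∑ u, edgeInd M s(v, u) = 1 := by
  obtain ⟨a, rfl⟩ := Sym2.mem_iff_exists.1 hv
  have : ∀ u, edgeInd M s(v, u) = if u = a then 1 else 0 := by
    intro u
    unfold edgeInd
    by_cases hu : u = a
    · simp [hu, he]
    · have : s(v, u) ∉ M := fun h =>
        hM.2 _ h _ he (mt Sym2.congr_right.1 hu) v (Sym2.mem_mk_left _ _) hv
      simp [hu, this]
  simp [this]

lemma MExposed.sum_edgeInd_eq_zero {M : Finset (Sym2 V)} {v : V} (hv : MExposed M v) :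
    ∑ u, edgeInd M s(v, u) = 0 := by
  refine Finset.sum_eq_zero fun u _ => ?_
  have : s(v, u) ∉ M := fun h => hv _ h (Sym2.mem_mk_left _ _)
  simp [edgeInd, this]

lemma IsMatching.isFracMatching_edgeInd {G : SimpleGraph V} {M : Finset (Sym2 V)}
    (hM : IsMatching G M) : IsFracMatching G (edgeInd M) := by
  refine ⟨fun e => ?_, fun e he => if_neg fun h => he (hM.1 h), fun v => ?_⟩
  · unfold edgeInd
    split_ifs <;> norm_num
  · by_cases hv : MExposed M v
    · rw [hv.sum_edgeInd_eq_zero]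
      exact zero_le_one
    · unfold MExposed at hv
      push Not at hv
      obtain ⟨e, he, hv⟩ := hv
      exact (hM.sum_edgeInd_eq_one he hv).le

lemma IsMaxFracMatching.nuf_eq {G : SimpleGraph V} {w x : Sym2 V → ℝ}
    (hx : IsMaxFracMatching G w x) : nuf G w = fracWeight w x := by
  refine IsGreatest.csSup_eq ⟨⟨x, hx.1, rfl⟩, ?_⟩
  rintro _ ⟨z, hz, rfl⟩
  exact hx.2 z hz

lemma isStable_of_forall_le {G : SimpleGraph V} {w : Sym2 V → ℝ} {M : Finset (Sym2 V)}
    (hM : IsMatching G M) (h : ∀ z, IsFracMatching G z → fracWeight w z ≤ setWeight w M) :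
    IsStable G w := by
  have h1 : nu G w = setWeight w M := by
    refine IsGreatest.csSup_eq ⟨⟨M, hM, rfl⟩, ?_⟩
    rintro _ ⟨N, hN, rfl⟩
    rw [← fracWeight_edgeInd]
    exact h _ hN.isFracMatching_edgeInd
  have h2 : IsMaxFracMatching G w (edgeInd M) :=
    ⟨hM.isFracMatching_edgeInd, fun z hz => (h z hz).trans_eq (fracWeight_edgeInd w M).symm⟩
  rw [IsStable, h1, h2.nuf_eq, fracWeight_edgeInd]

lemma IsStable.exists_setWeight_eq_coverValue {G : SimpleGraph V} {w : Sym2 V → ℝ}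
    (h : IsStable G w) :
    ∃ M y, IsMatching G M ∧ IsFracCover G w y ∧ setWeight w M = coverValue y := by
  obtain ⟨x, y, hx, hy, hxy⟩ := exists_fracWeight_eq_coverValue G w
  have hmax : IsMaxFracMatching G w x :=
    ⟨hx, fun z hz => (fracWeight_le_coverValue hz hy).trans_eq hxy.symm⟩
  obtain ⟨M, hM, hMw⟩ : nu G w ∈ {r : ℝ | ∃ M, IsMatching G M ∧ r = setWeight w M} := by
    refine Set.Nonempty.csSup_mem ⟨0, ∅, ⟨by simp, by simp⟩, by simp [setWeight]⟩ ?_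
    refine (Set.finite_range fun M : Finset (Sym2 V) => setWeight w M).subset ?_
    rintro _ ⟨M, -, rfl⟩
    exact ⟨M, rfl⟩
  exact ⟨M, y, hM, hy, by rw [← hMw, h, hmax.nuf_eq, hxy]⟩

/-- The sign of a real number, as an integer. -/
noncomputable def intSign (a : ℝ) : ℤ := (SignType.sign a : SignType)

lemma intSign_eq_zero {a : ℝ} : intSign a = 0 ↔ a = 0 := by
  rcases lt_trichotomy a 0 with h | rfl | h
  · simp [intSign, h, h.ne]
  · simp [intSign]
  · simp [intSign, h, h.ne']

lemma intSign_le_one (a : ℝ) : intSign a ≤ 1 := by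
  rcases lt_trichotomy a 0 with h | h | h <;> simp [intSign, h]

lemma intSign_nonneg {a : ℝ} (ha : 0 ≤ a) : 0 ≤ intSign a := by
  rcases ha.eq_or_lt with rfl | h
  · simp [intSign]
  · simp [intSign, h]

lemma intSign_add_nonneg {a b : ℝ} (h : 0 ≤ a + b) : 0 ≤ intSign a + intSign b := by
  unfold intSign
  rcases lt_trichotomy a 0 with ha | ha | ha <;> rcases lt_trichotomy b 0 with hb | hb | hb <;>
    simp [ha, hb] <;> linarith

lemma intSign_neg (a : ℝ) : intSign (-a) = -intSign a := by
  simp [intSign, Left.sign_neg]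

lemma intSign_nonpos {a : ℝ} (ha : a ≤ 0) : intSign a ≤ 0 := by
  have := intSign_nonneg (neg_nonneg.2 ha)
  rw [intSign_neg] at this
  linarith

lemma intSign_add_nonpos {a b : ℝ} (h : a + b ≤ 0) : intSign a + intSign b ≤ 0 := by
  have := intSign_add_nonneg (a := -a) (b := -b) (by linarith)
  rw [intSign_neg, intSign_neg] at this
  linarith

lemma even_sum_endSum {V : Type*} {G : SimpleGraph V} (s : V → ℤ) {u v : V} (p : G.Walk u v) :
    Even ((p.edges.map (endSum s)).sum + s u + s v) := by
  induction p with
  | nil => simp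
  | cons h p ih =>
    rename_i a b c
    have : ((p.cons h).edges.map (endSum s)).sum + s a + s c =
        ((p.edges.map (endSum s)).sum + s b + s c) + (s a + s a) := by
      simp only [SimpleGraph.Walk.edges_cons, List.map_cons, List.sum_cons, endSum_mk]
      ring
    rw [this]
    exact ih.add ⟨_, rfl⟩

lemma eq_neg_one_pow_mul_of_endSum_eq_zero {V : Type*} {G : SimpleGraph V} {s : V → ℤ} {u v : V}
    (p : G.Walk u v) (h : ∀ e ∈ p.edges, endSum s e = 0) : s u = (-1) ^ p.length * s v := by
  induction p with
  | nil => simp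
  | cons hadj p ih =>
    simp only [SimpleGraph.Walk.edges_cons, List.mem_cons, forall_eq_or_imp, endSum_mk] at h
    have := ih h.2
    rw [SimpleGraph.Walk.length_cons, pow_succ, mul_assoc, mul_comm, mul_assoc, mul_comm (s _),
      ← this]
    linarith [h.1]

lemma sum_endSum_le_neg_two {G : SimpleGraph V} {s : V → ℤ} {M C : Finset (Sym2 V)}
    (hC : IsOddCycleEdgeSet G C)
    (hM : ∀ e ∈ M, ∀ f ∈ M, e ≠ f → ∀ v : V, v ∈ e → v ∉ f)
    (hs : ∀ e ∈ C, endSum s e ≤ 0)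
    (h0 : ∀ a b, s(a, b) ∈ C → s(a, b) ∉ M → ¬(s a = 0 ∧ s b = 0)) :
    ∑ e ∈ C, endSum s e ≤ -2 := by
  obtain ⟨v, c, hc, hodd, rfl⟩ := hC
  have hsum : ∑ e ∈ c.edges.toFinset, endSum s e = (c.edges.map (endSum s)).sum :=
    List.sum_toFinset _ hc.edges_nodup
  have heven : Even (∑ e ∈ c.edges.toFinset, endSum s e) := by
    have := even_sum_endSum s c
    rw [← hsum, add_assoc, Int.even_add] at this
    exact this.2 ⟨_, rfl⟩
  have hle := Finset.sum_nonpos hs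
  by_cases hz : ∑ e ∈ c.edges.toFinset, endSum s e = 0
  · exfalso
    have hz' : ∀ e ∈ c.edges, endSum s e = 0 := fun e he =>
      (Finset.sum_eq_zero_iff_of_nonpos hs).1 hz e (List.mem_toFinset.2 he)
    have hv : s v = 0 := by
      have := eq_neg_one_pow_mul_of_endSum_eq_zero c hz'
      rw [hodd.neg_one_pow] at this
      linarith
    have hnd := hc.edges_nodup
    have h3 := hc.three_le_length
    cases c with
    | nil => simp at h3
    | cons h p =>
      rename_i b
      cases p with
      | nil => simp at h3
      | cons h' q =>
        rename_i d
        simp only [SimpleGraph.Walk.edges_cons, List.mem_cons, forall_eq_or_imp, endSum_mk] at hz'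
        simp only [SimpleGraph.Walk.edges_cons, List.nodup_cons, List.mem_cons, not_or] at hnd
        have hb : s b = 0 := by linarith [hz'.1]
        have hd : s d = 0 := by linarith [hz'.2.1]
        have h1 : s(v, b) ∈ M := by
          by_contra hn
          exact h0 v b (by simp) hn ⟨hv, hb⟩
        have h2 : s(b, d) ∈ M := by
          by_contra hn
          exact h0 b d (by simp) hn ⟨hb, hd⟩
        exact hM _ h1 _ h2 hnd.1.1 b (Sym2.mem_mk_right _ _) (Sym2.mem_mk_left _ _)
  · obtain ⟨k, hk⟩ := heven
    omega

lemma endSum_sub {V R : Type*} [AddCommGroup R] (p q : V → R) (e : Sym2 V) :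
    endSum (fun v => p v - q v) e = endSum p e - endSum q e := by
  induction e with | _ a b
  simp only [endSum_mk]
  abel

lemma endSum_intCast {V : Type*} (s : V → ℤ) (e : Sym2 V) :
    endSum (fun v => (s v : ℝ)) e = ((endSum s e : ℤ) : ℝ) := by
  induction e with | _ a b
  simp

lemma endSum_intSign_nonneg {V : Type*} {p : V → ℝ} {e : Sym2 V} (h : 0 ≤ endSum p e) :
    0 ≤ endSum (fun v => intSign (p v)) e := by
  induction e with | _ a b
  exact intSign_add_nonneg h

lemma endSum_intSign_nonpos {V : Type*} {p : V → ℝ} {e : Sym2 V} (h : endSum p e ≤ 0) :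
    endSum (fun v => intSign (p v)) e ≤ 0 := by
  induction e with | _ a b
  exact intSign_add_nonpos h

lemma endSum_intSign_le_two {V : Type*} (p : V → ℝ) (e : Sym2 V) :
    endSum (fun v => intSign (p v)) e ≤ 2 := by
  induction e with | _ a b
  rw [endSum_mk]
  linarith [intSign_le_one (p a), intSign_le_one (p b)]

lemma IsFracCover.le_endSum {G : SimpleGraph V} {w : Sym2 V → ℝ} {y : V → ℝ}
    (hy : IsFracCover G w y) {e : Sym2 V} (he : e ∈ G.edgeSet) : w e ≤ endSum y e := by
  induction e with | _ a b
  exact hy.2 a b he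

lemma IsCycleFamily.sum_eq {G : SimpleGraph V} {x : Sym2 V → ℝ} {𝒞 : Finset (Finset (Sym2 V))}
    (h : IsCycleFamily G x 𝒞) (f : Sym2 V → ℝ) :
    ∑ e, (if x e = 1 / 2 then f e else 0) = ∑ C ∈ 𝒞, ∑ e ∈ C, f e := by
  rw [← Finset.sum_filter, ← Finset.sum_biUnion]
  · refine Finset.sum_congr ?_ fun _ _ => rfl
    ext e
    simpa using h.2.2 e
  · intro C hC D hD hCD
    rw [Function.onFun, Finset.disjoint_left]
    intro e heC heD
    induction e with | _ a b
    exact Set.disjoint_left.1 (h.2.1 C hC D hD hCD) ⟨_, heC, Sym2.mem_mk_left a b⟩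
      ⟨_, heD, Sym2.mem_mk_left a b⟩

/-- If deleting `F` makes the matching `M` optimal, then a basic optimal fractional matching, for
weights perturbed in favour of `M`, has at most `2 |F|` odd cycles. -/
lemma card_cycleFamily_le_two_mul_card {G : SimpleGraph V} {w z : Sym2 V → ℝ}
    {F M : Finset (Sym2 V)} {y : V → ℝ} {ε : ℝ} {𝒞 : Finset (Finset (Sym2 V))}
    (hM : IsMatching (G.deleteEdges ↑F) M) (hy : IsFracCover (G.deleteEdges ↑F) w y)
    (hMy : setWeight w M = coverValue y) (hε : 0 < ε)
    (hz : IsMaxFracMatching G (fun e => if e ∈ M then w e else w e - ε) z)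
    (hz2 : IsHalfIntegral z) (h𝒞 : IsCycleFamily G z 𝒞) :
    𝒞.card ≤ 2 * F.card := by
  set w' : Sym2 V → ℝ := fun e => if e ∈ M then w e else w e - ε with hw'
  obtain ⟨x, y', hx, hy', hxy⟩ := exists_fracWeight_eq_coverValue G w'
  have hzy : fracWeight w' z = coverValue y' :=
    le_antisymm (fracWeight_le_coverValue hz.1 hy') (hxy ▸ hz.2 x hx)
  obtain ⟨hz3, hz4⟩ := slackness hz.1 hy' hzy
  have hMG := hM.isFracMatching_edgeInd
  obtain ⟨hM3, hM4⟩ := slackness hMG hy ((fracWeight_edgeInd w M).trans hMy)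
  set p : V → ℝ := fun v => y' v - y v with hp
  set s : V → ℤ := fun v => intSign (p v) with hs
  have hle : G.deleteEdges (↑F : Set (Sym2 V)) ≤ G := G.deleteEdges_le _
  have hMs : ∀ e ∈ M, 0 ≤ endSum s e := by
    intro e he
    refine endSum_intSign_nonneg ?_
    rw [hp, endSum_sub, ← hM3 e (by simp [edgeInd, he])]
    have := hy'.le_endSum (SimpleGraph.edgeSet_mono hle (hM.1 he))
    simp only [hw', he, if_true] at this
    linarith
  have hnonneg : (0 : ℝ) ≤ ∑ v, (s v : ℝ) := by
    have h1 : ∑ v, (s v : ℝ) * ∑ u, edgeInd M s(v, u) ≤ ∑ v, (s v : ℝ) := by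
      refine Finset.sum_le_sum fun v _ => ?_
      by_cases hv : y v = 0
      · refine mul_le_of_le_one_right ?_ (hMG.2.2 v)
        exact_mod_cast intSign_nonneg (by simpa [hp, hv] using hy'.1 v)
      · rw [hM4 v hv, mul_one]
    refine le_trans ?_ h1
    rw [sum_mul_load_eq _ hMG.diag_eq_zero]
    refine Finset.sum_nonneg fun e _ => ?_
    rw [endSum_intCast]
    by_cases he : e ∈ M
    · exact mul_nonneg (hMG.1 e) (by exact_mod_cast hMs e he)
    · simp [edgeInd, he]
  have hle2 : ∑ v, (s v : ℝ) ≤ ∑ e, z e * ((endSum s e : ℤ) : ℝ) := by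
    simp only [← endSum_intCast]
    rw [← sum_mul_load_eq _ hz.1.diag_eq_zero]
    refine Finset.sum_le_sum fun v _ => ?_
    by_cases hv : y' v = 0
    · have h1 : (s v : ℝ) ≤ 0 := by
        exact_mod_cast intSign_nonpos (by simpa [hp, hv] using hy.1 v)
      have h2 := hz.1.2.2 v
      nlinarith
    · rw [hz4 v hv, mul_one]
  have hzp : ∀ e, z e ≠ 0 → e ∉ F → endSum p e ≤ w' e - w e := by
    intro e he heF
    have heG : e ∈ G.edgeSet := by
      by_contra h
      exact he (hz.1.2.1 e h)
    have := hy.le_endSum (e := e) (by rw [SimpleGraph.edgeSet_deleteEdges]; exact ⟨heG, heF⟩)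
    rw [hp, endSum_sub, ← hz3 e he]
    linarith
  have hw'le : ∀ e, w' e ≤ w e := by
    intro e
    simp only [hw']
    split_ifs <;> linarith
  have hzs : ∀ e, z e ≠ 0 → e ∉ F → endSum s e ≤ 0 := fun e he heF =>
    endSum_intSign_nonpos ((hzp e he heF).trans (sub_nonpos.2 (hw'le e)))
  have hs2 : ∀ e, endSum s e ≤ 2 := endSum_intSign_le_two p
  have hcyc : ∀ C ∈ 𝒞, ∑ e ∈ C, (endSum s e - 4 * if e ∈ F then 1 else 0) ≤ -2 := by
    intro C hC
    have hz0 : ∀ e ∈ C, z e ≠ 0 := fun e he => by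
      rw [(h𝒞.2.2 e).2 ⟨C, hC, he⟩]
      norm_num
    by_cases hCF : ∃ f ∈ C, f ∈ F
    · obtain ⟨f, hf, hfF⟩ := hCF
      have hneg : ∀ e ∈ C, endSum s e - 4 * (if e ∈ F then 1 else 0) ≤ 0 := by
        intro e he
        split_ifs with heF
        · linarith [hs2 e]
        · linarith [hzs e (hz0 e he) heF]
      rw [← Finset.add_sum_erase _ _ hf]
      have h1 := Finset.sum_nonpos fun e he => hneg e (Finset.mem_of_mem_erase (a := f) he)
      have h2 := hs2 f
      simp only [hfF, if_true]
      linarith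
    · push Not at hCF
      rw [Finset.sum_congr rfl fun e he => by rw [if_neg (hCF e he), mul_zero, sub_zero]]
      refine sum_endSum_le_neg_two (h𝒞.1 C hC) hM.2 (fun e he => hzs e (hz0 e he) (hCF e he)) ?_
      rintro a b hab habM ⟨ha, hb⟩
      have h1 := hzp _ (hz0 _ hab) (hCF _ hab)
      simp only [hw', habM, if_false, endSum_mk, intSign_eq_zero.1 ha, intSign_eq_zero.1 hb] at h1
      linarith
  let k : Sym2 V → ℝ := fun e => ((endSum s e - 4 * if e ∈ F then 1 else 0 : ℤ) : ℝ) / 2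
  have hk : ∑ e, (if z e = 1 / 2 then k e else 0) ≤ -(𝒞.card : ℝ) := by
    rw [h𝒞.sum_eq]
    have : ∀ C ∈ 𝒞, ∑ e ∈ C, k e ≤ -1 := by
      intro C hC
      have : ((∑ e ∈ C, (endSum s e - 4 * if e ∈ F then 1 else 0) : ℤ) : ℝ) ≤ -2 := by
        exact_mod_cast hcyc C hC
      simp only [k, ← Finset.sum_div]
      rw [← Int.cast_sum]
      linarith
    refine (Finset.sum_le_sum this).trans ?_
    simp
  have hpt : ∀ e, z e * ((endSum s e : ℤ) : ℝ) ≤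
      (if z e = 1 / 2 then k e else 0) + 2 * if e ∈ F then 1 else 0 := by
    intro e
    have h2 : ((endSum s e : ℤ) : ℝ) ≤ 2 := by exact_mod_cast hs2 e
    have h3 : z e ≠ 0 → e ∉ F → ((endSum s e : ℤ) : ℝ) ≤ 0 := fun h h' => by exact_mod_cast hzs e h h'
    rcases hz2 e with h | h | h
    · rw [h]
      split_ifs <;> norm_num at *
    · simp only [h, k, if_true]
      push_cast
      linarith
    · rw [h] at h3 ⊢
      rw [if_neg (by norm_num)]
      split_ifs with heF
      · linarith
      · linarith [h3 one_ne_zero heF]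
  have hF : ∑ e, (2 * if e ∈ F then 1 else 0 : ℝ) = 2 * F.card := by
    rw [← Finset.mul_sum, Finset.sum_ite_mem]
    simp
  have htot := Finset.sum_le_sum fun e (_ : e ∈ Finset.univ) => hpt e
  rw [Finset.sum_add_distrib, hF] at htot
  have : (𝒞.card : ℝ) ≤ 2 * F.card := by linarith
  exact_mod_cast this

lemma finite_isHalfIntegral : {x : Sym2 V → ℝ | IsHalfIntegral x}.Finite := by
  refine (Set.Finite.pi' (t := fun _ : Sym2 V => ({0, 1 / 2, 1} : Set ℝ))
    fun _ => Set.toFinite _).subset ?_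
  intro x hx e
  simpa using hx e

lemma gamma_le_two_mul_card {G : SimpleGraph V} {w : Sym2 V → ℝ} {F : Finset (Sym2 V)}
    (h : IsStable (G.deleteEdges ↑F) w) : gamma G w ≤ 2 * F.card := by
  obtain ⟨M, y, hM, hy, hMy⟩ := h.exists_setWeight_eq_coverValue
  obtain ⟨x, -, hx, -, -⟩ := exists_basic_isMaxFracMatching G w
  set m := fracWeight w x with hm
  set B : ℝ := (Fintype.card (Sym2 V) : ℝ) with hB
  obtain ⟨ε, hεm, hε⟩ : ∃ ε : ℝ, (∀ z ∈ {z : Sym2 V → ℝ | IsHalfIntegral z},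
      fracWeight w z < m → fracWeight w z < m - ε * B) ∧ 0 < ε := by
    have h1 : ∀ᶠ ε : ℝ in nhdsWithin 0 (Set.Ioi 0), ∀ z ∈ {z : Sym2 V → ℝ | IsHalfIntegral z},
        fracWeight w z < m → fracWeight w z < m - ε * B := by
      rw [Filter.eventually_all_finite finite_isHalfIntegral]
      intro z _
      by_cases hz : fracWeight w z < m
      · have : Filter.Tendsto (fun ε : ℝ => m - ε * B) (nhds 0) (nhds (m - 0 * B)) :=
          Continuous.tendsto (by fun_prop) 0
        rw [zero_mul, sub_zero] at this
        filter_upwards [nhdsWithin_le_nhds (this.eventually_const_lt hz)] with ε hε _ using hε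
      · exact Filter.Eventually.of_forall fun _ h => absurd h hz
    exact (h1.and self_mem_nhdsWithin).exists
  obtain ⟨z, 𝒞, hz, hz2, h𝒞⟩ :=
    exists_basic_isMaxFracMatching G fun e => if e ∈ M then w e else w e - ε
  have h1 := card_cycleFamily_le_two_mul_card hM hy hMy hε hz hz2 h𝒞
  have hzx : m - ε * B ≤ fracWeight w z := by
    have h2 := hz.2 x hx.1
    have h3 : fracWeight (fun e => if e ∈ M then w e else w e - ε) z ≤ fracWeight w z := by
      refine Finset.sum_le_sum fun e _ => mul_le_mul_of_nonneg_right ?_ (hz.1.1 e)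
      dsimp only
      split_ifs <;> linarith
    have h4 : m - ε * B ≤ fracWeight (fun e => if e ∈ M then w e else w e - ε) x := by
      have : m - ε * B = ∑ e, (w e * x e - ε) := by
        rw [Finset.sum_sub_distrib]
        simp [hm, hB, fracWeight, mul_comm]
      rw [this]
      refine Finset.sum_le_sum fun e _ => ?_
      have h5 := hx.1.1 e
      have h6 := hx.1.le_one e
      dsimp only
      split_ifs
      · linarith
      · nlinarith
    linarith
  have hzw : IsMaxFracMatching G w z := by
    refine ⟨hz.1, fun t ht => (hx.2 t ht).trans ?_⟩
    by_contra! hlt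
    exact absurd (hεm z hz2 hlt) hzx.not_gt
  have hγ : gamma G w ≤ 𝒞.card := Nat.sInf_le ⟨z, 𝒞, hzw, hz2, h𝒞, rfl⟩
  exact hγ.trans h1

/-- A path of even length has a matching covering all of its vertices but the last one. -/
lemma exists_matching_of_even_path {G : SimpleGraph V} {v : V} (k : ℕ) :
    ∀ {u : V} (p : G.Walk u v), p.IsPath → p.length = 2 * k →
      ∃ N : Finset (Sym2 V), (∀ e ∈ N, e ∈ p.edges) ∧
        (∀ e ∈ N, ∀ f ∈ N, e ≠ f → ∀ a : V, a ∈ e → a ∉ f) ∧ (∀ e ∈ N, v ∉ e) ∧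
        ∀ a ∈ p.support, a ≠ v → ∃ e ∈ N, a ∈ e := by
  induction k with
  | zero =>
    intro u p _ hlen
    cases p with
    | nil => exact ⟨∅, by simp⟩
    | cons h p => simp at hlen
  | succ k ih =>
    intro u p hp hlen
    cases p with
    | nil => simp at hlen
    | cons h p =>
      rename_i b
      cases p with
      | nil => simp at hlen; omega
      | cons h' q =>
        simp only [SimpleGraph.Walk.cons_isPath_iff, SimpleGraph.Walk.support_cons, List.mem_cons,
          not_or] at hp
        simp only [SimpleGraph.Walk.length_cons] at hlen
        obtain ⟨N, hN1, hN2, hN3, hN4⟩ := ih q hp.1.1 (by omega)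
        have hNs : ∀ e ∈ N, ∀ a ∈ e, a ∈ q.support := fun e he a ha =>
          q.mem_support_of_mem_edges (hN1 e he) ha
        have hub : ∀ e ∈ N, ∀ a ∈ s(u, b), a ∉ e := by
          intro e he a ha hae
          rcases Sym2.mem_iff.1 ha with rfl | rfl
          · exact hp.2.2 (hNs e he _ hae)
          · exact hp.1.2 (hNs e he _ hae)
        refine ⟨insert s(u, b) N, ?_, ?_, ?_, ?_⟩
        · simp only [Finset.forall_mem_insert, SimpleGraph.Walk.edges_cons, List.mem_cons, true_or,
            true_and]
          exact fun e he => Or.inr (Or.inr (hN1 e he))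
        · simp only [Finset.forall_mem_insert, ne_eq, not_true_eq_false, false_imp_iff, true_and]
          exact ⟨fun f hf _ a ha => hub f hf a ha,
            fun e he => ⟨fun _ a ha hab => hub e he a hab ha, hN2 e he⟩⟩
        · simp only [Finset.forall_mem_insert]
          refine ⟨fun hv => ?_, hN3⟩
          rcases Sym2.mem_iff.1 hv with rfl | rfl
          · exact hp.2.2 q.end_mem_support
          · exact hp.1.2 q.end_mem_support
        · simp only [SimpleGraph.Walk.support_cons, List.forall_mem_cons, Finset.exists_mem_insert]
          exact ⟨fun _ => Or.inl (Sym2.mem_mk_left _ _), fun _ => Or.inl (Sym2.mem_mk_right _ _),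
            fun a ha hav => Or.inr (hN4 a ha hav)⟩

lemma IsOddCycleEdgeSet.exists_matching {G : SimpleGraph V} {C : Finset (Sym2 V)}
    (hC : IsOddCycleEdgeSet G C) :
    ∃ (S : Finset V) (N : Finset (Sym2 V)), S.card ≤ 1 ∧ ↑S ⊆ edgeVerts C ∧ N ⊆ C ∧
      (∀ e ∈ N, ∀ f ∈ N, e ≠ f → ∀ a : V, a ∈ e → a ∉ f) ∧ (∀ e ∈ N, ∀ a ∈ S, a ∉ e) ∧
      ∀ a ∈ edgeVerts C, a ∉ S → ∃ e ∈ N, a ∈ e := by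
  obtain ⟨v, c, hc, hodd, rfl⟩ := hC
  cases c with
  | nil => simp at hodd
  | cons h p =>
    rename_i b
    rw [SimpleGraph.Walk.length_cons] at hodd
    obtain ⟨k, hk⟩ := hodd
    obtain ⟨N, hN1, hN2, hN3, hN4⟩ := exists_matching_of_even_path k p
      ((SimpleGraph.Walk.cons_isCycle_iff _ _).1 hc).1 (by omega)
    refine ⟨{v}, N, by simp, ?_, ?_, hN2, by simpa using hN3, ?_⟩
    · simp only [Finset.coe_singleton, Set.singleton_subset_iff]
      refine ⟨s(v, b), ?_, Sym2.mem_mk_left _ _⟩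
      rw [List.mem_toFinset, SimpleGraph.Walk.edges_cons]
      exact List.mem_cons_self
    · intro e he
      simp [hN1 e he]
    · rintro a ⟨e, he, hae⟩ hav
      refine hN4 a ?_ (by simpa using hav)
      have := SimpleGraph.Walk.mem_support_of_mem_edges (List.mem_toFinset.1 he) hae
      rw [SimpleGraph.Walk.support_cons, List.mem_cons] at this
      exact this.resolve_left (by simpa using hav)

lemma exists_basic_card_eq_gamma (G : SimpleGraph V) (w : Sym2 V → ℝ) :
    ∃ x 𝒞, IsMaxFracMatching G w x ∧ IsHalfIntegral x ∧ IsCycleFamily G x 𝒞 ∧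
      𝒞.card = gamma G w := by
  obtain ⟨x, 𝒞, h1, h2, h3⟩ := exists_basic_isMaxFracMatching G w
  exact Nat.sInf_mem (s := {n : ℕ | ∃ (x : Sym2 V → ℝ) (F : Finset (Finset (Sym2 V))),
    IsMaxFracMatching G w x ∧ IsHalfIntegral x ∧ IsCycleFamily G x F ∧ F.card = n})
    ⟨_, x, 𝒞, h1, h2, h3, rfl⟩

lemma exists_edgeStabilizer_card_le (G : SimpleGraph V) [DecidableRel G.Adj] (w : Sym2 V → ℝ) :
    ∃ F : Finset (Sym2 V), ↑F ⊆ G.edgeSet ∧ IsStable (G.deleteEdges ↑F) w ∧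
      F.card ≤ G.maxDegree * gamma G w := by
  obtain ⟨x, 𝒞, hx, hx2, h𝒞, hcard⟩ := exists_basic_card_eq_gamma G w
  choose! S N hS1 hSC hNC hN hNS hcov using fun C hC => (h𝒞.1 C hC).exists_matching
  have hhalf : ∀ C ∈ 𝒞, ∀ e ∈ C, x e = 1 / 2 := fun C hC e he => (h𝒞.2.2 e).2 ⟨C, hC, he⟩
  set T := 𝒞.biUnion S with hT
  set F := T.biUnion fun v => G.incidenceFinset v with hF
  set M := oneEdges x ∪ 𝒞.biUnion N with hMdef
  have hmemF : ∀ e, e ∈ F ↔ ∃ C ∈ 𝒞, ∃ v ∈ S C, e ∈ G.edgeSet ∧ v ∈ e := by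
    intro e
    simp only [hF, hT, Finset.mem_biUnion, SimpleGraph.mem_incidenceFinset]
    exact ⟨fun ⟨v, ⟨C, hC, hv⟩, he⟩ => ⟨C, hC, v, hv, he⟩,
      fun ⟨C, hC, v, hv, he⟩ => ⟨v, ⟨C, hC, hv⟩, he⟩⟩
  have hmemM : ∀ e, e ∈ M ↔ x e = 1 ∨ ∃ C ∈ 𝒞, e ∈ N C := by
    intro e
    simp [hMdef, oneEdges]
  have hge : ∀ e ∈ M, 1 / 2 ≤ x e := by
    intro e he
    rcases (hmemM e).1 he with h | ⟨C, hC, he⟩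
    · rw [h]
      norm_num
    · exact (hhalf C hC e (hNC C hC he)).ge
  have hFG : ↑F ⊆ G.edgeSet := by
    intro e he
    obtain ⟨C, -, v, -, h, -⟩ := (hmemF e).1 he
    exact h
  have hone : ∀ e, x e = 1 → ∀ C ∈ 𝒞, ∀ v ∈ edgeVerts C, v ∉ e := by
    rintro e he C hC v ⟨f, hf, hvf⟩ hve
    have hfe := hhalf C hC f hf
    have := hx.1.add_le_one (e := e) (f := f) (by rintro rfl; norm_num [he] at hfe) hve hvf
    rw [he, hfe] at this
    norm_num at this
  have hdisj : ∀ C ∈ 𝒞, ∀ D ∈ 𝒞, ∀ v ∈ edgeVerts C, v ∈ edgeVerts D → C = D := by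
    intro C hC D hD v hv hv'
    by_contra h
    exact Set.disjoint_left.1 (h𝒞.2.1 C hC D hD h) hv hv'
  have hM : IsMatching (G.deleteEdges ↑F) M := by
    constructor
    · intro e he
      rw [SimpleGraph.edgeSet_deleteEdges]
      have he' := hge e he
      refine ⟨?_, fun heF => ?_⟩
      · by_contra h
        rw [hx.1.2.1 e h] at he'
        norm_num at he'
      · obtain ⟨C, hC, v, hv, -, hve⟩ := (hmemF e).1 heF
        rcases (hmemM e).1 he with h | ⟨D, hD, heD⟩
        · exact hone e h C hC v (hSC C hC hv) hve
        · have := hdisj C hC D hD v (hSC C hC hv) ⟨e, hNC D hD heD, hve⟩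
          subst this
          exact hNS C hC e heD v hv hve
    · intro e he f hf hef v hve hvf
      rcases (hmemM e).1 he with h | ⟨C, hC, heC⟩
      · have := hx.1.add_le_one hef hve hvf
        linarith [hge f hf]
      · rcases (hmemM f).1 hf with h | ⟨D, hD, hfD⟩
        · have := hx.1.add_le_one hef hve hvf
          linarith [hge e he]
        · have := hdisj C hC D hD v ⟨e, hNC C hC heC, hve⟩ ⟨f, hNC D hD hfD, hvf⟩
          subst this
          exact hN C hC e heC f hfD hef v hve hvf
  refine ⟨F, hFG, isStable_of_forall_le hM fun z hz => ?_, ?_⟩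
  · have ht : IsFracMatching G fun e => x e + (z e - edgeInd M e) / 2 := by
      refine ⟨fun e => ?_, fun e he => ?_, fun v => ?_⟩
      · have h1 := hz.1 e
        have h2 := hx.1.1 e
        dsimp only [edgeInd]
        split_ifs with he
        · linarith [hge e he]
        · linarith
      · have h1 : e ∉ M := fun h => he (SimpleGraph.edgeSet_mono (G.deleteEdges_le _) (hM.1 h))
        have h2 : z e = 0 := hz.2.1 e fun h => he (SimpleGraph.edgeSet_mono (G.deleteEdges_le _) h)
        simp [edgeInd, h1, h2, hx.1.2.1 e he]
      · rw [Finset.sum_add_distrib, ← Finset.sum_div, Finset.sum_sub_distrib]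
        have hxv := hx.1.2.2 v
        have hzv := hz.2.2 v
        by_cases hv : MExposed M v
        · rw [hv.sum_edgeInd_eq_zero]
          by_cases hvT : ∃ C ∈ 𝒞, v ∈ S C
          · obtain ⟨C, hC, hvC⟩ := hvT
            have : ∑ u, z s(v, u) = 0 := by
              refine Finset.sum_eq_zero fun u _ => hz.2.1 _ ?_
              rw [SimpleGraph.edgeSet_deleteEdges]
              exact fun h => h.2 ((hmemF _).2 ⟨C, hC, v, hvC, h.1, Sym2.mem_mk_left _ _⟩)
            linarith
          · have : ∑ u, x s(v, u) = 0 := by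
              refine Finset.sum_eq_zero fun u _ => ?_
              rcases hx2 s(v, u) with h | h | h
              · exact h
              · obtain ⟨C, hC, hvC⟩ := (h𝒞.2.2 _).1 h
                obtain ⟨e, he, hve⟩ := hcov C hC v ⟨_, hvC, Sym2.mem_mk_left _ _⟩
                  fun h => hvT ⟨C, hC, h⟩
                exact absurd hve (hv e ((hmemM e).2 (Or.inr ⟨C, hC, he⟩)))
              · exact absurd (Sym2.mem_mk_left _ _) (hv _ ((hmemM _).2 (Or.inl h)))
            linarith
        · unfold MExposed at hv
          push Not at hv
          obtain ⟨e, he, hve⟩ := hv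
          rw [hM.sum_edgeInd_eq_one he hve]
          linarith
    have h1 := hx.2 _ ht
    have h2 : fracWeight w (fun e => x e + (z e - edgeInd M e) / 2) =
        fracWeight w x + (fracWeight w z - fracWeight w (edgeInd M)) / 2 := by
      simp only [fracWeight, ← Finset.sum_sub_distrib, Finset.sum_div, ← Finset.sum_add_distrib]
      exact Finset.sum_congr rfl fun e _ => by ring
    rw [h2, fracWeight_edgeInd] at h1
    linarith
  · have hTc : T.card ≤ gamma G w := by
      rw [← hcard, ← mul_one 𝒞.card]
      exact Finset.card_biUnion_le_card_mul _ _ _ hS1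
    rw [mul_comm]
    refine (Finset.card_biUnion_le_card_mul _ _ G.maxDegree fun v _ => ?_).trans
      (Nat.mul_le_mul_right _ hTc)
    rw [SimpleGraph.card_incidenceFinset_eq_degree]
    exact G.degree_le_maxDegree v

/-- `G` admits an edge-stabilizer `F` with |F| ≤ Δ·γ(G); consequently
(since every edge-stabilizer has cardinality at least ⌈γ(G)/2⌉) `F` is a
2Δ-approximation to a minimum edge-stabilizer. -/
theorem exists_edgeStabilizer_maxDegree
    {V : Type*} [Fintype V] [DecidableEq V]
    (G : SimpleGraph V) [DecidableRel G.Adj]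
    (w : Sym2 V → ℝ) (hw : ∀ e, 0 ≤ w e) :
    ∃ F : Finset (Sym2 V), ↑F ⊆ G.edgeSet ∧ IsStable (G.deleteEdges ↑F) w ∧
      F.card ≤ G.maxDegree * gamma G w ∧
      ∀ F' : Finset (Sym2 V), ↑F' ⊆ G.edgeSet → IsStable (G.deleteEdges ↑F') w →
        F.card ≤ 2 * G.maxDegree * F'.card := by
  obtain ⟨F, hFG, hF, hcard⟩ := exists_edgeStabilizer_card_le G w
  refine ⟨F, hFG, hF, hcard, fun F' _ hF' => hcard.trans ?_⟩
  rw [mul_comm 2, mul_assoc]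
  exact Nat.mul_le_mul_left _ (gamma_le_two_mul_card hF')

end Stabilizer
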